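/- arXiv:1007.1501 — 9 statements merged into one kernel-verified Lean document; each statement's English description precedes it below -/
import Mathlib

section
/- Suppose all influences are non-negative (T_{j,i} ≥ 0 for all i, j). Then for every price p, the pessimistic equilibrium q̲(p) and the optimistic equilibrium q̄(p) are both equilibria at price p, i.e. f_p(q̲(p)) = q̲(p) and f_p(q̄(p)) = q̄(p). -/
open Filter Topology

/-- med{0,1,x} = max(0, min(1, x)). -/
noncomputable def med (x : ℝ) : ℝ := max 0 (min 1 x)

/-- The transfer function `f_p` of the pricing game. -/
noncomputable def transfer {ι : Type*} [Fintype ι] (a b : ι → ℝ)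
    (T : Matrix ι ι ℝ) (p : ℝ) (q : ι → ℝ) : ι → ℝ :=
  fun i => med ((b i - p + ∑ j, T j i * q j) / (b i - a i))

/-- The transfer function is continuous. -/
theorem continuous_transfer {ι : Type*} [Fintype ι] (a b : ι → ℝ) (T : Matrix ι ι ℝ) (p : ℝ) :
    Continuous (transfer a b T p) := by
  unfold transfer med
  fun_prop

/-- with non-negative influences, the pessimistic equilibrium
(the componentwise limit of `f_p^{(m)}(0)`) and the optimistic equilibrium
(the componentwise limit of `f_p^{(m)}(1)`) are both fixed points of `f_p`. -/
theorem pessimistic_and_optimistic_are_equilibria (n : ℕ) (a b : Fin n → ℝ)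
    (T : Matrix (Fin n) (Fin n) ℝ)
    (ha : ∀ i, 0 ≤ a i) (hab : ∀ i, a i < b i)
    (hTdiag : ∀ i, T i i = 0) (hTnn : ∀ i j, 0 ≤ T j i)
    (p : ℝ) (ql qu : Fin n → ℝ)
    (hql : ∀ i, Tendsto (fun m : ℕ => (transfer a b T p)^[m] (fun _ => 0) i)
      atTop (𝓝 (ql i)))
    (hqu : ∀ i, Tendsto (fun m : ℕ => (transfer a b T p)^[m] (fun _ => 1) i)
      atTop (𝓝 (qu i))) :
    transfer a b T p ql = ql ∧ transfer a b T p qu = qu := by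
  have hcont := continuous_transfer a b T p
  exact ⟨isFixedPt_of_tendsto_iterate (tendsto_pi_nhds.2 hql) hcont.continuousAt,
    isFixedPt_of_tendsto_iterate (tendsto_pi_nhds.2 hqu) hcont.continuousAt⟩
end

section
/- Suppose all influences are non-negative (T_{j,i} ≥ 0 for all i, j). For any two prices p_1 ≤ p_2, one has q̲(p_1) ≥ q̲(p_2) and q̄(p_1) ≥ q̄(p_2) componentwise. -/
open Filter Topology

theorem med_mono : Monotone med := fun _ _ h =>
  max_le_max le_rfl (min_le_min le_rfl h)

/-- With non-negative influences the transfer function is jointly antitone in the price and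
monotone in the purchase probabilities. -/
theorem transfer_le_transfer {ι : Type*} [Fintype ι] {a b : ι → ℝ} {T : Matrix ι ι ℝ}
    (hab : ∀ i, a i ≤ b i) (hT : ∀ i j, 0 ≤ T j i) {p₁ p₂ : ℝ} (hp : p₁ ≤ p₂)
    {q r : ι → ℝ} (hqr : q ≤ r) : transfer a b T p₂ q ≤ transfer a b T p₁ r := by
  intro i
  have hsum : ∑ j, T j i * q j ≤ ∑ j, T j i * r j :=
    Finset.sum_le_sum fun j _ => mul_le_mul_of_nonneg_left (hqr j) (hT i j)
  exact med_mono (div_le_div_of_nonneg_right (by linarith) (sub_nonneg.2 (hab i)))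

theorem iterate_transfer_antitone_price {ι : Type*} [Fintype ι] {a b : ι → ℝ}
    {T : Matrix ι ι ℝ} (hab : ∀ i, a i ≤ b i) (hT : ∀ i j, 0 ≤ T j i) {p₁ p₂ : ℝ}
    (hp : p₁ ≤ p₂) (m : ℕ) (q : ι → ℝ) :
    (transfer a b T p₂)^[m] q ≤ (transfer a b T p₁)^[m] q :=
  Monotone.iterate_le_of_le (fun _ _ h => transfer_le_transfer hab hT le_rfl h)
    (fun _ => transfer_le_transfer hab hT hp le_rfl) m q

/-- with non-negative influences, the pessimistic and optimistic
equilibria are componentwise non-increasing in the price: if `p₁ ≤ p₂` then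
`q̲(p₁) ≥ q̲(p₂)` and `q̄(p₁) ≥ q̄(p₂)`. -/
theorem equilibria_antitone_in_price (n : ℕ) (a b : Fin n → ℝ)
    (T : Matrix (Fin n) (Fin n) ℝ)
    (ha : ∀ i, 0 ≤ a i) (hab : ∀ i, a i < b i)
    (hTdiag : ∀ i, T i i = 0) (hTnn : ∀ i j, 0 ≤ T j i)
    (p₁ p₂ : ℝ) (hp : p₁ ≤ p₂)
    (ql₁ ql₂ qu₁ qu₂ : Fin n → ℝ)
    (hql₁ : ∀ i, Tendsto (fun m : ℕ => (transfer a b T p₁)^[m] (fun _ => 0) i)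
      atTop (𝓝 (ql₁ i)))
    (hql₂ : ∀ i, Tendsto (fun m : ℕ => (transfer a b T p₂)^[m] (fun _ => 0) i)
      atTop (𝓝 (ql₂ i)))
    (hqu₁ : ∀ i, Tendsto (fun m : ℕ => (transfer a b T p₁)^[m] (fun _ => 1) i)
      atTop (𝓝 (qu₁ i)))
    (hqu₂ : ∀ i, Tendsto (fun m : ℕ => (transfer a b T p₂)^[m] (fun _ => 1) i)
      atTop (𝓝 (qu₂ i))) :
    (∀ i, ql₂ i ≤ ql₁ i) ∧ (∀ i, qu₂ i ≤ qu₁ i) := by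
  have hiter := iterate_transfer_antitone_price (fun i => (hab i).le) hTnn hp
  exact ⟨fun i => le_of_tendsto_of_tendsto' (hql₂ i) (hql₁ i) fun m => hiter m _ i,
    fun i => le_of_tendsto_of_tendsto' (hqu₂ i) (hqu₁ i) fun m => hiter m _ i⟩
end

section
/- For every n×n real influence matrix T with zero diagonal (entries may be negative) and every price p, there exists at least one equilibrium: some q ∈ [0,1]^n with f_p(q) = q. -/
open Filter Topology

open MeasureTheory Set Metric
open scoped NNReal

section Lipschitz

variable {X E : Type*} [PseudoMetricSpace X] [NormedAddCommGroup E] [NormedSpace ℝ E]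

/-- The product of a bounded Lipschitz scalar function and a bounded Lipschitz vector function is
Lipschitz. -/
theorem LipschitzWith.smul_of_bounded {c : X → ℝ} {v : X → E} {A B M N : ℝ≥0}
    (hc : LipschitzWith A c) (hcM : ∀ x, |c x| ≤ M) (hv : LipschitzWith B v)
    (hvN : ∀ x, ‖v x‖ ≤ N) : LipschitzWith (M * B + A * N) fun x => c x • v x := by
  refine LipschitzWith.of_dist_le_mul fun x y => ?_
  have hsplit : c x • v x - c y • v y = c x • (v x - v y) + (c x - c y) • v y := by
    rw [smul_sub, sub_smul]; abel
  have h1 := hc.dist_le_mul x y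
  have h2 := hv.dist_le_mul x y
  rw [Real.dist_eq] at h1
  rw [dist_eq_norm] at h2
  rw [dist_eq_norm, hsplit]
  calc ‖c x • (v x - v y) + (c x - c y) • v y‖
      ≤ |c x| * ‖v x - v y‖ + |c x - c y| * ‖v y‖ := by
        simpa [norm_smul] using norm_add_le (c x • (v x - v y)) ((c x - c y) • v y)
    _ ≤ M * (B * dist x y) + (A * dist x y) * N := by
        gcongr
        · exact hcM x
        · exact hvN y
    _ = ↑(M * B + A * N) * dist x y := by push_cast; ring

/-- The normalization map, regularized near the origin, is Lipschitz. -/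
theorem lipschitzWith_inv_max_norm_smul {δ : ℝ≥0} (hδ : 0 < δ) :
    LipschitzWith (2 / δ) fun y : E => (max ‖y‖ δ)⁻¹ • y := by
  refine LipschitzWith.of_dist_le_mul fun y z => ?_
  have hδ' : (0 : ℝ) < δ := hδ
  set m : E → ℝ := fun y => max ‖y‖ δ with hm
  have hmδ : ∀ y, (δ : ℝ) ≤ m y := fun y => le_max_right _ _
  have hmpos : ∀ y, 0 < m y := fun y => hδ'.trans_le (hmδ y)
  have hmdiff : |m z - m y| ≤ ‖y - z‖ := by
    refine (abs_max_sub_max_le_abs _ _ _).trans ?_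
    rw [norm_sub_rev]
    exact abs_norm_sub_norm_le z y
  have hsplit : (m y)⁻¹ • y - (m z)⁻¹ • z
      = (m y)⁻¹ • (y - z) + ((m y)⁻¹ * (m z - m y)) • ((m z)⁻¹ • z) := by
    rw [smul_smul, smul_sub]
    have : (m y)⁻¹ * (m z - m y) * (m z)⁻¹ = (m y)⁻¹ - (m z)⁻¹ := by
      field_simp [(hmpos y).ne', (hmpos z).ne']
    rw [this, sub_smul]; abel
  have hunit : ‖(m z)⁻¹ • z‖ ≤ 1 := by
    rw [norm_smul, norm_inv, Real.norm_of_nonneg (hmpos z).le, inv_mul_le_one₀ (hmpos z)]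
    exact le_max_left _ _
  rw [dist_eq_norm, dist_eq_norm]
  change ‖(m y)⁻¹ • y - (m z)⁻¹ • z‖ ≤ _
  have hinv : (m y)⁻¹ ≤ (δ : ℝ)⁻¹ := inv_anti₀ hδ' (hmδ y)
  have hinv0 : 0 ≤ (m y)⁻¹ := (inv_pos.2 (hmpos y)).le
  rw [hsplit]
  calc _ ≤ ‖(m y)⁻¹ • (y - z)‖ + ‖((m y)⁻¹ * (m z - m y)) • ((m z)⁻¹ • z)‖ := norm_add_le _ _
    _ = (m y)⁻¹ * ‖y - z‖ + (m y)⁻¹ * |m z - m y| * ‖(m z)⁻¹ • z‖ := by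
        rw [norm_smul, norm_smul _ ((m z)⁻¹ • z), norm_mul, Real.norm_of_nonneg hinv0,
          Real.norm_eq_abs]
    _ ≤ (δ : ℝ)⁻¹ * ‖y - z‖ + (δ : ℝ)⁻¹ * ‖y - z‖ * 1 := by gcongr
    _ = ↑(2 / δ) * ‖y - z‖ := by push_cast; ring

end Lipschitz

section Perturbation

/-- A perturbation of the identity by a contraction is bijective. -/
theorem bijective_add_of_lipschitzWith {E : Type*} [NormedAddCommGroup E] [CompleteSpace E]
    {g : E → E} {c : ℝ≥0} (hc : c < 1) (hg : LipschitzWith c g) :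
    Function.Bijective fun x => x + g x := by
  constructor
  · intro x y hxy
    have h := hg.dist_le_mul x y
    have hxy' : x - y = g y - g x := by
      have : x + g x = y + g y := hxy
      rw [sub_eq_sub_iff_add_eq_add, this, add_comm]
    rw [dist_comm, dist_eq_norm, ← hxy', dist_eq_norm] at h
    have hc' : (c : ℝ) < 1 := hc
    have : ‖x - y‖ = 0 := by nlinarith [norm_nonneg (x - y)]
    exact sub_eq_zero.1 (norm_eq_zero.1 this)
  · intro y
    have hcontr : ContractingWith c fun x => y - g x := by
      refine ⟨hc, LipschitzWith.of_dist_le_mul fun u v => ?_⟩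
      simpa only [dist_sub_left] using hg.dist_le_mul u v
    refine ⟨hcontr.fixedPoint, ?_⟩
    have h : y - g hcontr.fixedPoint = hcontr.fixedPoint := hcontr.fixedPoint_isFixedPt
    exact (sub_eq_iff_eq_add.1 h).symm

/-- A bijection that fixes every point outside `s` maps `s` onto `s`. -/
theorem image_eq_of_bijective_of_eq_self {α : Type*} {F : α → α} {s : Set α}
    (hF : Function.Bijective F) (hs : ∀ x ∉ s, F x = x) : F '' s = s := by
  refine Subset.antisymm ?_ fun y hy => ?_
  · rintro _ ⟨x, hx, rfl⟩
    by_contra hFx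
    exact hFx (by rwa [hF.1 (hs _ hFx)])
  · obtain ⟨x, rfl⟩ := hF.2 y
    by_contra h
    have hx : x ∉ s := fun hx => h ⟨x, hx, rfl⟩
    exact hx (hs x hx ▸ hy)

variable {E : Type*} [NormedAddCommGroup E] [NormedSpace ℝ E]

theorem det_one_add_pos [FiniteDimensional ℝ E] {A : E →L[ℝ] E} (hA : ‖A‖ < 1) :
    0 < (1 + A : E →L[ℝ] E).det := by
  have hne : ∀ s ∈ Icc (0 : ℝ) 1, (1 + s • A : E →L[ℝ] E).det ≠ 0 := by
    intro s hs hdet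
    obtain ⟨x, hx, hx0⟩ := (Submodule.ne_bot_iff _).1 (LinearMap.bot_lt_ker_of_det_eq_zero hdet).ne'
    have hx' : x + s • A x = 0 := by simpa using hx
    have hnorm : ‖x‖ = s * ‖A x‖ := by
      simpa [norm_smul, abs_of_nonneg hs.1] using congrArg norm (eq_neg_of_add_eq_zero_left hx')
    have hpos : 0 < ‖x‖ := norm_pos_iff.2 hx0
    have h1 : s * ‖A x‖ ≤ 1 * (‖A‖ * ‖x‖) :=
      mul_le_mul hs.2 (A.le_opNorm x) (norm_nonneg _) zero_le_one
    nlinarith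
  have hcont : ContinuousOn (fun s : ℝ => (1 + s • A : E →L[ℝ] E).det) (Icc 0 1) :=
    (ContinuousLinearMap.continuous_det.comp (by fun_prop)).continuousOn
  by_contra hle
  have h0 : (1 + (0 : ℝ) • A : E →L[ℝ] E).det = 1 := by
    simp [ContinuousLinearMap.det]
  have hmem : (0 : ℝ) ∈ Icc ((1 + (1 : ℝ) • A : E →L[ℝ] E).det)
      ((1 + (0 : ℝ) • A : E →L[ℝ] E).det) := by
    rw [h0, one_smul]
    exact ⟨not_lt.1 hle, zero_le_one⟩
  obtain ⟨s, hs, hs0⟩ := intermediate_value_Icc' zero_le_one hcont hmem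
  exact hne s hs hs0

/-- A map of constant norm has singular derivative. -/
theorem det_eq_zero_of_eventually_norm_eq [FiniteDimensional ℝ E] {r : E → E} {x : E}
    {A : E →L[ℝ] E} {K : ℝ} (hK : 0 < K) (hr : ∀ᶠ y in 𝓝 x, ‖r y‖ = K)
    (hA : HasFDerivAt r A x) : A.det = 0 := by
  have hrx : ‖r x‖ = K := hr.self_of_nhds
  obtain ⟨φ, hφ, hφx⟩ := exists_dual_vector ℝ (r x) (by rw [hrx]; exact hK.ne')
  have hφx' : φ (r x) = K := by rw [hφx, hrx]; rfl
  have hmax : IsLocalMax (fun y => φ (r y)) x := by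
    filter_upwards [hr] with y hy
    rw [hφx', ← hy]
    simpa [hφ] using (le_abs_self _).trans (φ.le_opNorm (r y))
  have hzero : φ.comp A = 0 := hmax.hasFDerivAt_eq_zero (φ.hasFDerivAt.comp x hA)
  by_contra hdet
  have hsurj : Function.Surjective A := by
    have := LinearMap.isUnit_iff_isUnit_det (A : E →ₗ[ℝ] E) |>.2 (isUnit_iff_ne_zero.2 hdet)
    exact ((Module.End.isUnit_iff _).1 this).2
  obtain ⟨y, hy⟩ := hsurj (r x)
  have : φ (A y) = 0 := DFunLike.congr_fun hzero y
  rw [hy, hφx'] at this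
  exact hK.ne' this

/-- Interpolation of `t ↦ det (1 + t • A)` at `1` with weights which do not depend on `A`. -/
theorem det_one_add_eq_sum {n : ℕ} {v : ℕ → ℝ} (hv : Function.Injective v)
    (A : (Fin n → ℝ) →L[ℝ] (Fin n → ℝ)) :
    (1 + A).det = ∑ k ∈ Finset.range (n + 1),
      (Lagrange.basis (Finset.range (n + 1)) v k).eval 1 * (1 + v k • A).det := by
  let M := LinearMap.toMatrix' (A : (Fin n → ℝ) →ₗ[ℝ] (Fin n → ℝ))
  let P : Polynomial ℝ := ((Polynomial.X : Polynomial ℝ) • M.map Polynomial.C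
    + (1 : Matrix (Fin n) (Fin n) ℝ).map Polynomial.C).det
  have hP : ∀ t : ℝ, P.eval t = (1 + t • A).det := by
    intro t
    rw [ContinuousLinearMap.det, ← LinearMap.det_toMatrix', Polynomial.eval]
    change Polynomial.eval₂RingHom (RingHom.id ℝ) t _ = _
    rw [RingHom.map_det]
    congr 1
    ext i j
    have hentry : (LinearMap.toMatrix' (1 + t • A : (Fin n → ℝ) →L[ℝ] (Fin n → ℝ)).toLinearMap) i j
        = M i j * t + (1 : Matrix (Fin n) (Fin n) ℝ) i j := by
      simp [M, LinearMap.toMatrix'_apply, Matrix.one_apply, Pi.single_apply, add_comm, mul_comm t]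
    rw [hentry]
    by_cases hij : i = j <;> simp [Matrix.one_apply, hij]
  have hdeg : P.degree < (Finset.range (n + 1)).card := by
    refine Polynomial.degree_le_natDegree.trans_lt ?_
    have := Polynomial.natDegree_det_X_add_C_le M 1
    rw [Fintype.card_fin] at this
    rw [Finset.card_range]
    exact_mod_cast Nat.lt_succ_of_le this
  have h := congrArg (Polynomial.eval 1) (Lagrange.eq_interpolate (v := v) hv.injOn hdeg)
  rw [hP, one_smul, Lagrange.interpolate_apply, Polynomial.eval_finsetSum] at h
  simp only [Polynomial.eval_mul, Polynomial.eval_C, hP] at h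
  rw [h]
  exact Finset.sum_congr rfl fun k _ => mul_comm _ _

end Perturbation

section FixedPoint

variable {n : ℕ}

theorem LipschitzWith.volume_image_eq_zero {F : (Fin n → ℝ) → Fin n → ℝ} {L : ℝ≥0}
    (hF : LipschitzWith L F) {s : Set (Fin n → ℝ)} (hs : volume s = 0) : volume (F '' s) = 0 := by
  rw [← hausdorffMeasure_pi_real] at hs ⊢
  have h := hF.hausdorffMeasure_image_le (d := (Fintype.card (Fin n) : ℝ)) (by positivity) s
  rwa [hs, mul_zero, nonpos_iff_eq_zero] at h

/-- The Jacobian determinant of a small perturbation of the identity supported in a ball is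
integrable on the ball and integrates to its volume. -/
theorem integral_det_one_add_fderiv {g : (Fin n → ℝ) → Fin n → ℝ} {c : ℝ≥0} (hc : c < 1) {K : ℝ}
    (hg : LipschitzWith c g) (hK : ∀ x ∉ ball (0 : Fin n → ℝ) K, g x = 0) :
    IntegrableOn (fun x => (1 + fderiv ℝ g x).det) (ball 0 K) ∧
      ∫ x in ball 0 K, (1 + fderiv ℝ g x).det = volume.real (ball (0 : Fin n → ℝ) K) := by
  set F : (Fin n → ℝ) → Fin n → ℝ := fun x => x + g x with hF
  set B := ball (0 : Fin n → ℝ) K with hB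
  set D := B ∩ {x | DifferentiableAt ℝ g x} with hD
  have hFbij : Function.Bijective F := bijective_add_of_lipschitzWith hc hg
  have hFB : F '' B = B := image_eq_of_bijective_of_eq_self hFbij fun x hx => by simp [hF, hK x hx]
  have hDmeas : MeasurableSet D :=
    measurableSet_ball.inter (measurableSet_of_differentiableAt ℝ g)
  have hnull : volume (B \ D) = 0 := by
    refine measure_mono_null (fun x hx => ?_) hg.ae_differentiableAt
    exact fun h => hx.2 ⟨hx.1, h⟩
  have hDB : D =ᵐ[volume] B :=
    inter_subset_left.eventuallyLE.antisymm (ae_le_set.2 hnull)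
  have hFlip : LipschitzWith (1 + c) F := LipschitzWith.id.add hg
  have hFD : F '' D =ᵐ[volume] B := by
    have hsub : F '' D ⊆ B := (image_mono inter_subset_left).trans hFB.subset
    refine hsub.eventuallyLE.antisymm (ae_le_set.2 ?_)
    rw [← hFB, ← image_sdiff hFbij.1]
    exact hFlip.volume_image_eq_zero hnull
  have hderiv : ∀ x ∈ D, HasFDerivWithinAt F (1 + fderiv ℝ g x) D x := fun x hx =>
    ((hasFDerivAt_id x).add hx.2.hasFDerivAt).hasFDerivWithinAt
  have habs : ∀ x, |(1 + fderiv ℝ g x).det| • (1 : ℝ) = (1 + fderiv ℝ g x).det := by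
    intro x
    rw [smul_eq_mul, mul_one, abs_of_pos (det_one_add_pos _)]
    exact (norm_fderiv_le_of_lipschitz ℝ hg).trans_lt hc
  have hint := integrableOn_image_iff_integrableOn_abs_det_fderiv_smul volume hDmeas hderiv
    hFbij.1.injOn (fun _ => (1 : ℝ))
  have heq := integral_image_eq_integral_abs_det_fderiv_smul volume hDmeas hderiv
    hFbij.1.injOn (fun _ => (1 : ℝ))
  simp only [habs] at hint heq
  rw [setIntegral_congr_set hFD, setIntegral_congr_set hDB] at heq
  rw [integrableOn_congr_set_ae hFD, integrableOn_congr_set_ae hDB] at hint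
  refine ⟨hint.1 (integrableOn_const (by rw [hB]; exact measure_ball_lt_top.ne)), ?_⟩
  rw [← heq]
  simp

/-- There is no Lipschitz retraction of a ball onto its boundary sphere. -/
theorem not_exists_lipschitzWith_retraction {g : (Fin n → ℝ) → Fin n → ℝ} {L : ℝ≥0} {K : ℝ}
    (hK : 0 < K) (hg : LipschitzWith L g) (hout : ∀ x ∉ ball (0 : Fin n → ℝ) K, g x = 0)
    (hin : ∀ x ∈ ball (0 : Fin n → ℝ) K, ‖x + g x‖ = K) : False := by
  set B := ball (0 : Fin n → ℝ) K with hB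
  set v : ℕ → ℝ≥0 := fun k => (L + 1 + k)⁻¹ with hv
  have hvinj : Function.Injective fun k => (v k : ℝ) := by
    intro i j hij
    have : v i = v j := NNReal.coe_injective hij
    simpa [hv] using this
  have hvL : ∀ k, v k * L < 1 := by
    intro k
    rw [hv, inv_mul_lt_one₀ (by positivity), add_assoc]
    exact lt_add_of_pos_right _ (by positivity)
  have hsmul : ∀ k, LipschitzWith (v k * L) fun x => (v k : ℝ) • g x := fun k => by
    refine LipschitzWith.of_dist_le_mul fun x y => ?_
    rw [dist_smul₀, Real.norm_of_nonneg (v k).coe_nonneg, NNReal.coe_mul, mul_assoc]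
    gcongr
    exact hg.dist_le_mul x y
  have hk : ∀ k, IntegrableOn (fun x => (1 + (v k : ℝ) • fderiv ℝ g x).det) B ∧
      ∫ x in B, (1 + (v k : ℝ) • fderiv ℝ g x).det = volume.real B := fun k => by
    have h := integral_det_one_add_fderiv (hvL k) (hsmul k)
      (K := K) (fun x hx => by simp [hout x hx])
    have hfd : ∀ x, fderiv ℝ (fun x => (v k : ℝ) • g x) x = (v k : ℝ) • fderiv ℝ g x :=
      fun x => congrFun (fderiv_const_smul_field (v k : ℝ)) x
    simpa only [hfd] using h
  have hzero : ∫ x in B, (1 + fderiv ℝ g x).det = 0 := by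
    refine integral_eq_zero_of_ae ?_
    filter_upwards [ae_restrict_mem measurableSet_ball,
      ae_restrict_of_ae (hg.ae_differentiableAt (μ := volume))] with x hx hdiff
    refine det_eq_zero_of_eventually_norm_eq hK ?_ ((hasFDerivAt_id x).add hdiff.hasFDerivAt)
    filter_upwards [isOpen_ball.mem_nhds hx] with y hy using hin y hy
  have hsum : ∫ x in B, (1 + fderiv ℝ g x).det = volume.real B := by
    rw [integral_congr_ae (.of_forall fun x => det_one_add_eq_sum hvinj (fderiv ℝ g x)),
      integral_finsetSum _ fun k _ => (hk k).1.const_mul _]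
    simp_rw [integral_const_mul, (hk _).2]
    rw [← Finset.sum_mul, ← Polynomial.eval_finsetSum,
      Lagrange.sum_basis hvinj.injOn ⟨0, by simp⟩, Polynomial.eval_one, one_mul]
  have hpos : 0 < volume.real B :=
    ENNReal.toReal_pos (measure_ball_pos volume 0 hK).ne' measure_ball_lt_top.ne
  exact hpos.ne' (hsum.symm.trans hzero)

/-- A bounded Lipschitz self-map of `ℝⁿ` has a fixed point. -/
theorem LipschitzWith.exists_isFixedPt_of_bounded {f : (Fin n → ℝ) → Fin n → ℝ} {L R : ℝ≥0}
    (hf : LipschitzWith L f) (hR : ∀ x, ‖f x‖ ≤ R) : ∃ x, f x = x := by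
  by_contra! hfix
  set cut : (Fin n → ℝ) → ℝ := fun x => max 0 (min 1 (R + 1 - ‖x‖)) with hcut
  have hcut0 : ∀ x, 0 ≤ cut x := fun x => le_max_left _ _
  have hcut1 : ∀ x, cut x ≤ 1 := fun x => max_le zero_le_one (min_le_left _ _)
  have hcutin : ∀ x, ‖x‖ ≤ R → cut x = 1 := fun x hx => by
    rw [hcut]; dsimp only
    rw [min_eq_left (by linarith), max_eq_right zero_le_one]
  have hcutout : ∀ x, (R : ℝ) + 1 ≤ ‖x‖ → cut x = 0 := fun x hx =>
    max_eq_left ((min_le_right _ _).trans (by linarith))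
  have hconst_sub : ∀ a : ℝ, LipschitzWith 1 fun x : Fin n → ℝ => a - ‖x‖ := fun a => by
    refine LipschitzWith.of_dist_le_mul fun x y => ?_
    rw [dist_sub_left]
    exact lipschitzWith_one_norm.dist_le_mul x y
  have hcutlip : LipschitzWith 1 cut := ((hconst_sub _).const_min 1).const_max 0
  have hcutf : LipschitzWith (1 * L + 1 * R) fun x => cut x • f x :=
    hcutlip.smul_of_bounded (fun x => by simpa [abs_of_nonneg (hcut0 x)] using hcut1 x) hf hR
  have hcutR : ∀ x, ‖cut x • f x‖ ≤ R := fun x => by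
    rw [norm_smul, Real.norm_of_nonneg (hcut0 x)]
    exact (mul_le_of_le_one_left (norm_nonneg _) (hcut1 x)).trans (hR x)
  set w : (Fin n → ℝ) → Fin n → ℝ := fun x => x - cut x • f x with hw
  have hwlip : LipschitzWith (1 + (1 * L + 1 * R)) w := LipschitzWith.id.sub hcutf
  have hw0 : ∀ x, w x ≠ 0 := fun x hx => by
    have hx' : x = cut x • f x := sub_eq_zero.1 hx
    have hxR : ‖x‖ ≤ R := by rw [hx']; exact hcutR x
    rw [hcutin x hxR, one_smul] at hx'
    exact hfix x hx'.symm
  have hwout : ∀ x, (R : ℝ) + 1 ≤ ‖x‖ → w x = x := fun x hx => by simp [hw, hcutout x hx]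
  set K : ℝ := 2 * R + 1 with hKdef
  have hR0 : (0 : ℝ) ≤ R := R.2
  have hK : 0 < K := by positivity
  have hwK : ∀ x ∈ ball (0 : Fin n → ℝ) K, ‖w x‖ ≤ K := fun x hx => by
    rw [mem_ball_zero_iff] at hx
    by_cases h : (R : ℝ) + 1 ≤ ‖x‖
    · rw [hwout x h]; exact hx.le
    · have := (_root_.norm_sub_le x (cut x • f x)).trans (add_le_add_right (hcutR x) _)
      change ‖x - cut x • f x‖ ≤ K
      linarith
  obtain ⟨δ, hδ, hwδ⟩ : ∃ δ : ℝ≥0, 0 < δ ∧ ∀ x ∈ ball (0 : Fin n → ℝ) K, (δ : ℝ) ≤ ‖w x‖ := by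
    obtain ⟨z, -, hz⟩ := (isCompact_closedBall (0 : Fin n → ℝ) K).exists_isMinOn
      ⟨0, mem_closedBall_self hK.le⟩ hwlip.continuous.norm.continuousOn
    exact ⟨‖w z‖₊, nnnorm_pos.2 (hw0 z), fun x hx => hz (ball_subset_closedBall hx)⟩
  set h : (Fin n → ℝ) → Fin n → ℝ := fun y => max 0 (K - ‖y‖) • ((max ‖y‖ δ)⁻¹ • y) with hh
  have hhlip : LipschitzWith (⟨K, hK.le⟩ * (2 / δ) + 1 * 1) h := by
    refine ((hconst_sub K).const_max 0).smul_of_bounded (fun y => ?_)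
      (lipschitzWith_inv_max_norm_smul hδ) fun y => ?_
    · rw [abs_of_nonneg (le_max_left _ _)]
      exact max_le hK.le (sub_le_self K (norm_nonneg y))
    · have hm : 0 < max ‖y‖ (δ : ℝ) := lt_max_of_lt_right hδ
      rw [norm_smul, norm_inv, Real.norm_of_nonneg hm.le, NNReal.coe_one, inv_mul_le_one₀ hm]
      exact le_max_left _ _
  refine not_exists_lipschitzWith_retraction (g := fun x => h (w x) - cut x • f x) hK
    ((hhlip.comp hwlip).sub hcutf) (fun x hx => ?_) fun x hx => ?_
  · rw [mem_ball_zero_iff, not_lt] at hx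
    have hx' : (R : ℝ) + 1 ≤ ‖x‖ := by linarith
    have : max 0 (K - ‖x‖) = 0 := max_eq_left (by linarith)
    simp [hwout x hx', hcutout x hx', hh, this]
  · have hpos : 0 < ‖w x‖ := norm_pos_iff.2 (hw0 x)
    have hsum : x + (h (w x) - cut x • f x) = (K * ‖w x‖⁻¹) • w x := by
      have : h (w x) = ((K - ‖w x‖) * ‖w x‖⁻¹) • w x := by
        rw [hh]; dsimp only
        rw [max_eq_right (sub_nonneg.2 (hwK x hx)), max_eq_left (hwδ x hx), smul_smul]
      rw [this, sub_mul, mul_inv_cancel₀ hpos.ne', sub_smul, one_smul]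
      simp only [hw]
      abel
    rw [hsum, norm_smul, norm_mul, norm_inv, norm_norm, Real.norm_of_nonneg hK.le,
      inv_mul_cancel_right₀ hpos.ne']

end FixedPoint

section Transfer

theorem med_mem_Icc (x : ℝ) : med x ∈ Icc (0 : ℝ) 1 :=
  ⟨le_max_left _ _, max_le zero_le_one (min_le_left _ _)⟩

theorem lipschitzWith_med : LipschitzWith 1 med := (LipschitzWith.id.const_min 1).const_max 0

theorem exists_lipschitzWith_transfer {ι : Type*} [Fintype ι] (a b : ι → ℝ) (T : Matrix ι ι ℝ)
    (p : ℝ) : ∃ L, LipschitzWith L (transfer a b T p) := by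
  let A : ι → (ι → ℝ) →L[ℝ] ℝ := fun i =>
    (b i - a i)⁻¹ • ∑ j, T j i • ContinuousLinearMap.proj (R := ℝ) (φ := fun _ : ι => ℝ) j
  have hA : ∀ i q, transfer a b T p q i = med ((b i - p) / (b i - a i) + A i q) := fun i q => by
    simp [transfer, A, mul_add, div_eq_inv_mul, sum_apply]
  refine ⟨∑ i, ‖A i‖₊, LipschitzWith.of_dist_le_mul fun x y => ?_⟩
  refine (dist_pi_le_iff (by positivity)).2 fun i => ?_
  rw [hA, hA]
  refine (lipschitzWith_med.dist_le_mul _ _).trans ?_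
  rw [NNReal.coe_one, one_mul, dist_add_left]
  refine ((A i).lipschitz.dist_le_mul x y).trans ?_
  gcongr
  exact Finset.single_le_sum (f := fun i => ‖A i‖₊) (fun _ _ => zero_le) (Finset.mem_univ i)

end Transfer

/-- for any influence matrix `T` with zero diagonal (entries may be
negative) and any price `p`, there exists an equilibrium: a fixed point of the
transfer function `f_p` in `[0,1]^n`. -/
theorem equilibrium_exists (n : ℕ) (a b : Fin n → ℝ)
    (T : Matrix (Fin n) (Fin n) ℝ)
    (ha : ∀ i, 0 ≤ a i) (hab : ∀ i, a i < b i)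
    (hTdiag : ∀ i, T i i = 0)
    (p : ℝ) :
    ∃ q : Fin n → ℝ, (∀ i, q i ∈ Set.Icc (0:ℝ) 1) ∧ transfer a b T p q = q := by
  obtain ⟨L, hL⟩ := exists_lipschitzWith_transfer a b T p
  obtain ⟨q, hq⟩ := hL.exists_isFixedPt_of_bounded (R := 1) fun x => by
    refine (pi_norm_le_iff_of_nonneg zero_le_one).2 fun i => ?_
    exact (Real.norm_of_nonneg (med_mem_Icc _).1).trans_le (med_mem_Icc _).2
  refine ⟨q, fun i => ?_, hq⟩
  rw [← hq]
  exact med_mem_Icc _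
end

section
/- Let n ≥ 4 and consider the instance with price p = 1, valuation intervals [a_1,b_1] = [0,2] and [a_i,b_i] = [0,1] for 2 ≤ i ≤ n, and influences T_{i,i+1} = 1/2 for 1 ≤ i ≤ n−2, T_{n−1,n} = T_{n,n−1} = 1, and all other entries of T equal to 0. Then: (i) f_p^{(n−2)}(0) = (1/2, 1/2^2, …, 1/2^{n−2}, 0, 0); (ii) for every integer 0 ≤ k ≤ 2^{n−2}, f_p^{(n−2+2k)}(0) = (1/2, 1/2^2, …, 1/2^{n−2}, k/2^{n−1}, k/2^{n−1}); (iii) for every integer 0 ≤ k < 2^{n−2}, f_p^{(n−2+2k+1)}(0) = (1/2, 1/2^2, …, 1/2^{n−2}, (k+1)/2^{n−1}, k/2^{n−1}); and (iv) the pessimistic equilibrium is q̲(1) = (1/2, 1/2^2, …, 1/2^{n−2}, 1, 1). In particular, iterating the transfer function from 0 requires at least 2^{n−2} steps before reaching the fixed point. -/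
open Filter Topology

theorem med_eq_self {x : ℝ} (h0 : 0 ≤ x) (h1 : x ≤ 1) : med x = x := by
  simp [med, h0, h1]

theorem med_eq_one {x : ℝ} (h : 1 ≤ x) : med x = 1 := by
  simp [med, h]

/-- The coordinatewise description of the transfer function of a chain of `n` agents, where each
of the first `n - 2` agents passes on half of its value and the last two influence each other. -/
structure IsChainStep {n : ℕ} (F : (Fin n → ℝ) → Fin n → ℝ) : Prop where
  head : ∀ q i, i.val = 0 → F q i = 1 / 2
  next : ∀ q j i, j.val + 1 = i.val → i.val + 3 ≤ n → F q i = med (q j / 2)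
  penultimate : ∀ q j i l, j.val + 3 = n → i.val + 2 = n → l.val + 1 = n →
    F q i = med (q j / 2 + q l)
  last : ∀ q j i, j.val + 2 = n → i.val + 1 = n → F q i = med (q j)

theorem isChainStep_transfer {n : ℕ} (hn : 4 ≤ n)
    {a b : Fin n → ℝ} {T : Matrix (Fin n) (Fin n) ℝ}
    (haa : ∀ i, a i = 0)
    (hbb : ∀ i, b i = if i.val = 0 then 2 else 1)
    (hTT : ∀ j i, T j i =
      if j.val + 1 = i.val ∧ i.val + 2 ≤ n then (1/2 : ℝ)
      else if (j.val = n - 2 ∧ i.val = n - 1) ∨ (j.val = n - 1 ∧ i.val = n - 2)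
        then 1 else 0) :
    IsChainStep (transfer a b T 1) where
  head q i hi := by
    have hsum : ∑ j, T j i * q j = 0 := by
      refine Finset.sum_eq_zero fun j _ => ?_
      rw [hTT, if_neg (by lia), if_neg (by lia), zero_mul]
    rw [transfer, hsum, hbb, haa, if_pos hi]
    norm_num [med]
  next q j i hji hi := by
    have hsum : ∑ j, T j i * q j = q j / 2 := by
      rw [Fintype.sum_eq_single j fun x hx => ?_]
      · rw [hTT, if_pos (by lia)]
        ring
      · have := Fin.val_ne_of_ne hx
        rw [hTT, if_neg (by lia), if_neg (by lia), zero_mul]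
    rw [transfer, hsum, hbb, haa, if_neg (by lia)]
    norm_num
  penultimate q j i l hj hi hl := by
    have hsum : ∑ j, T j i * q j = q j / 2 + q l := by
      rw [Fintype.sum_eq_add j l (Fin.ne_of_val_ne (by lia)) fun x hx => ?_]
      · rw [hTT, hTT, if_pos (by lia), if_neg (by lia), if_pos (by lia)]
        ring
      · have := Fin.val_ne_of_ne hx.1
        have := Fin.val_ne_of_ne hx.2
        rw [hTT, if_neg (by lia), if_neg (by lia), zero_mul]
    rw [transfer, hsum, hbb, haa, if_neg (by lia)]
    norm_num
  last q j i hj hi := by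
    have hsum : ∑ j, T j i * q j = q j := by
      rw [Fintype.sum_eq_single j fun x hx => ?_]
      · rw [hTT, if_neg (by lia), if_pos (by lia), one_mul]
      · have := Fin.val_ne_of_ne hx
        rw [hTT, if_neg (by lia), if_neg (by lia), zero_mul]
    rw [transfer, hsum, hbb, haa, if_neg (by lia)]
    norm_num

/-- The vector `(1/2, 1/2^2, …, 1/2^(n-2), x, y)`. -/
noncomputable def chainState (n : ℕ) (x y : ℝ) : Fin n → ℝ :=
  fun i => if i.val + 3 ≤ n then (1/2 : ℝ)^(i.val + 1) else if i.val = n - 2 then x else y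

theorem chainState_self (n : ℕ) (x : ℝ) :
    chainState n x x = fun i => if i.val + 3 ≤ n then (1/2 : ℝ)^(i.val + 1) else x := by
  ext i
  simp only [chainState, ite_self]

theorem med_half_pow_div_two (m : ℕ) : med ((1/2 : ℝ)^m / 2) = (1/2)^(m + 1) := by
  have h1 : (1/2 : ℝ)^m ≤ 1 := pow_le_one₀ (by norm_num) (by norm_num)
  have h0 : (0 : ℝ) ≤ (1/2)^m := by positivity
  rw [med_eq_self (by linarith) (by linarith)]
  ring

namespace IsChainStep

variable {n : ℕ} {F : (Fin n → ℝ) → Fin n → ℝ}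

theorem apply_chainState (hF : IsChainStep F) (hn : 4 ≤ n) (x y : ℝ) :
    F (chainState n x y) = chainState n (med (1 / 2^(n - 1) + y)) (med x) := by
  ext i
  by_cases hi : i.val + 3 ≤ n
  · rcases Nat.eq_zero_or_pos i.val with h0 | h0
    · rw [hF.head _ i h0, chainState, if_pos hi, h0]
      norm_num
    · rw [hF.next _ ⟨i.val - 1, by lia⟩ i (Nat.sub_add_cancel h0) hi, chainState, chainState,
        if_pos (by grind), if_pos hi, med_half_pow_div_two]
      congr 1
      grind
  · by_cases hi' : i.val = n - 2
    · rw [hF.penultimate _ ⟨n - 3, by lia⟩ i ⟨n - 1, by lia⟩ (by grind) (by grind) (by grind)]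
      have hpow : (1/2 : ℝ)^(n - 3 + 1) / 2 = 1 / 2^(n - 1) := by
        rw [show n - 1 = n - 3 + 1 + 1 by lia, one_div_pow, pow_succ _ (n - 3 + 1), div_div]
      simp only [chainState]
      rw [if_pos (by lia), if_neg (by lia), if_neg (by lia), if_neg hi, if_pos hi', hpow]
    · rw [hF.last _ ⟨n - 2, by lia⟩ i (by grind) (by grind)]
      simp only [chainState, hi, hi', if_false]
      rw [if_neg (by lia)]
      simp

theorem iterate_zero (hF : IsChainStep F) (hn : 4 ≤ n) (m : ℕ) (hm : m + 2 ≤ n) :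
    F^[m] (fun _ => 0) =
      fun i => if i.val < m ∧ i.val + 3 ≤ n then (1/2 : ℝ)^(i.val + 1) else 0 := by
  have med_zero : med 0 = 0 := med_eq_self le_rfl zero_le_one
  induction m with
  | zero => simp
  | succ m ih =>
    rw [Function.iterate_succ_apply', ih (by lia)]
    ext i
    by_cases hi : i.val + 3 ≤ n
    · rcases Nat.eq_zero_or_pos i.val with h0 | h0
      · rw [hF.head _ i h0, if_pos (by lia), h0]
        norm_num
      · rw [hF.next _ ⟨i.val - 1, by lia⟩ i (Nat.sub_add_cancel h0) hi]
        by_cases him : i.val < m + 1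
        · rw [if_pos (by grind), if_pos ⟨him, hi⟩, med_half_pow_div_two]
          congr 1
          grind
        · rw [if_neg (by grind), if_neg (by grind), zero_div, med_zero]
    · rw [if_neg (by lia)]
      by_cases hi' : i.val + 2 = n
      · rw [hF.penultimate _ ⟨n - 3, by lia⟩ i ⟨n - 1, by lia⟩ (by grind) hi' (by grind),
          if_neg (by grind), if_neg (by grind), zero_div, add_zero, med_zero]
      · rw [hF.last _ ⟨n - 2, by lia⟩ i (by grind) (by grind), if_neg (by grind), med_zero]

theorem iterate_sub_two (hF : IsChainStep F) (hn : 4 ≤ n) :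
    F^[n - 2] (fun _ => 0) = chainState n 0 0 := by
  rw [hF.iterate_zero hn _ (by lia), chainState_self]
  ext i
  congr 1
  grind

theorem apply_chainState_div (hF : IsChainStep F) (hn : 4 ≤ n) (k : ℕ) (hk : k < 2^(n - 1)) :
    F (chainState n (k / 2^(n - 1)) (k / 2^(n - 1))) =
      chainState n ((k + 1) / 2^(n - 1)) (k / 2^(n - 1)) := by
  have hk' : (k : ℝ) + 1 ≤ 2^(n - 1) := by exact_mod_cast hk
  have hpos : (0 : ℝ) < 2^(n - 1) := by positivity
  rw [hF.apply_chainState hn, ← add_div, add_comm 1,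
    med_eq_self (by positivity) ((div_le_one hpos).2 hk'),
    med_eq_self (by positivity) ((div_le_one hpos).2 (by linarith))]

theorem iterate_even (hF : IsChainStep F) (hn : 4 ≤ n) (k : ℕ) (hk : k ≤ 2^(n - 1)) :
    F^[n - 2 + 2 * k] (fun _ => 0) = chainState n (k / 2^(n - 1)) (k / 2^(n - 1)) := by
  induction k with
  | zero => simpa using hF.iterate_sub_two hn
  | succ k ih =>
    have hk' : (k : ℝ) + 1 ≤ 2^(n - 1) := by exact_mod_cast hk
    have hpos : (0 : ℝ) < 2^(n - 1) := by positivity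
    rw [show n - 2 + 2 * (k + 1) = n - 2 + 2 * k + 1 + 1 by ring, Function.iterate_succ_apply',
      Function.iterate_succ_apply', ih (by lia), hF.apply_chainState_div hn k hk,
      hF.apply_chainState hn, ← add_div, add_comm 1,
      med_eq_self (by positivity) ((div_le_one hpos).2 hk'), Nat.cast_succ]

theorem iterate_odd (hF : IsChainStep F) (hn : 4 ≤ n) (k : ℕ) (hk : k < 2^(n - 1)) :
    F^[n - 2 + 2 * k + 1] (fun _ => 0) = chainState n ((k + 1) / 2^(n - 1)) (k / 2^(n - 1)) := by
  rw [Function.iterate_succ_apply', hF.iterate_even hn k hk.le, hF.apply_chainState_div hn k hk]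

theorem isFixedPt_chainState_one (hF : IsChainStep F) (hn : 4 ≤ n) :
    Function.IsFixedPt F (chainState n 1 1) := by
  rw [Function.IsFixedPt, hF.apply_chainState hn, med_eq_one le_rfl,
    med_eq_one (le_add_of_nonneg_left (by positivity))]

theorem iterate_eq_of_le (hF : IsChainStep F) (hn : 4 ≤ n) {m m' : ℕ} (hm : m ≤ m')
    (h : F^[m] (fun _ => 0) = chainState n 1 1) : F^[m'] (fun _ => 0) = chainState n 1 1 := by
  rw [← Nat.sub_add_cancel hm, Function.iterate_add_apply, h]
  exact (hF.isFixedPt_chainState_one hn).iterate _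

theorem tendsto_iterate (hF : IsChainStep F) (hn : 4 ≤ n) (i : Fin n) :
    Tendsto (fun m : ℕ => F^[m] (fun _ => 0) i) atTop (𝓝 (chainState n 1 1 i)) := by
  refine tendsto_atTop_of_eventually_const (i₀ := n - 2 + 2 * 2^(n - 1)) fun m hm => ?_
  rw [hF.iterate_eq_of_le hn hm]
  rw [hF.iterate_even hn _ le_rfl]
  simp

theorem le_of_iterate_eq (hF : IsChainStep F) (hn : 4 ≤ n) {m : ℕ}
    (h : F^[m] (fun _ => 0) = chainState n 1 1) : 2^(n - 2) ≤ m := by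
  by_contra! hm
  have hlt : 2^(n - 2) < 2^(n - 1) := Nat.pow_lt_pow_right (by norm_num) (by lia)
  have heq := (hF.iterate_even hn _ hlt.le).symm.trans (hF.iterate_eq_of_le hn (by lia) h)
  have hlast := congrFun heq ⟨n - 1, by lia⟩
  rw [chainState_self, chainState_self] at hlast
  simp only at hlast
  rw [if_neg (by lia), if_neg (by lia), div_eq_one_iff_eq (by positivity)] at hlast
  exact hlt.ne (by exact_mod_cast hlast)

end IsChainStep

/-- the explicit instance (agents `1,…,n` are indexed by `Fin n`,
agent `i` of the paper being index `i-1`) with price `p = 1`,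
`[a₁,b₁] = [0,2]`, `[aᵢ,bᵢ] = [0,1]` for `i ≥ 2`, chain influences
`T_{i,i+1} = 1/2` for `1 ≤ i ≤ n−2`, `T_{n−1,n} = T_{n,n−1} = 1`, and all other
influences `0`.  The iterates of the transfer function from `0` behave as
described in items (i)–(iv), and in particular at least `2^{n−2}` iterations are
needed to reach the fixed point `q̲(1)`. -/
theorem iteration_takes_exponential_time (n : ℕ) (hn : 4 ≤ n)
    (a b : Fin n → ℝ) (T : Matrix (Fin n) (Fin n) ℝ)
    (haa : ∀ i, a i = 0)
    (hbb : ∀ i, b i = if i.val = 0 then 2 else 1)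
    (hTT : ∀ j i, T j i =
      if j.val + 1 = i.val ∧ i.val + 2 ≤ n then (1/2 : ℝ)
      else if (j.val = n - 2 ∧ i.val = n - 1) ∨ (j.val = n - 1 ∧ i.val = n - 2)
        then 1 else 0) :
    -- (i)
    ((transfer a b T 1)^[n - 2] (fun _ => 0) =
      fun i => if i.val + 3 ≤ n then (1/2 : ℝ)^(i.val + 1) else 0) ∧
    -- (ii)
    (∀ k : ℕ, k ≤ 2^(n - 2) →
      (transfer a b T 1)^[n - 2 + 2 * k] (fun _ => 0) =
        fun i => if i.val + 3 ≤ n then (1/2 : ℝ)^(i.val + 1)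
          else (k : ℝ) / 2^(n - 1)) ∧
    -- (iii)
    (∀ k : ℕ, k < 2^(n - 2) →
      (transfer a b T 1)^[n - 2 + 2 * k + 1] (fun _ => 0) =
        fun i => if i.val + 3 ≤ n then (1/2 : ℝ)^(i.val + 1)
          else if i.val = n - 2 then ((k : ℝ) + 1) / 2^(n - 1)
          else (k : ℝ) / 2^(n - 1)) ∧
    -- (iv): the pessimistic equilibrium q̲(1)
    (∀ i, Tendsto (fun m : ℕ => (transfer a b T 1)^[m] (fun _ => 0) i) atTop
      (𝓝 (if i.val + 3 ≤ n then (1/2 : ℝ)^(i.val + 1) else 1))) ∧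
    -- in particular: reaching the fixed point needs at least 2^(n-2) iterations
    (∀ m : ℕ,
      ((transfer a b T 1)^[m] (fun _ => 0) =
        fun i => if i.val + 3 ≤ n then (1/2 : ℝ)^(i.val + 1) else 1) →
      2^(n - 2) ≤ m) := by
  have hF := isChainStep_transfer hn haa hbb hTT
  have hlt : 2^(n - 2) < 2^(n - 1) := Nat.pow_lt_pow_right (by norm_num) (by lia)
  simp only [← chainState_self]
  exact ⟨hF.iterate_sub_two hn, fun k hk => hF.iterate_even hn k (hk.trans hlt.le),
    fun k hk => hF.iterate_odd hn k (hk.trans hlt),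
    fun i => by simpa only [chainState_self] using hF.tendsto_iterate hn i,
    fun m hm => hF.le_of_iterate_eq hn hm⟩
end

section
/- Assume all influences are non-negative and I − L is strictly diagonally dominant. Let Z ∪ W ∪ O = {1,…,n} be a partition into disjoint sets and set y_i = 1/(b_i − a_i). Then I − L_{W×W} is invertible with entrywise non-negative inverse, and the vector ℓ ∈ ℝ^n defined by ℓ_W = (I − L_{W×W})^{-1} y_W and ℓ_i = y_i + Σ_{j∈W} L_{i,j} ℓ_j for i ∈ Z ∪ O has all entries strictly positive. Consequently, if Z ∪ W ≠ ∅ and c ∈ ℝ^n satisfies c_i < 0 for all i ∈ Z and c_i < 1 for all i ∈ W, then ε_min = min( min_{i∈Z} (−c_i)/ℓ_i , min_{i∈W} (1 − c_i)/ℓ_i ) is strictly positive. -/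
open Filter Topology

namespace Matrix

variable {ι : Type*} [Fintype ι] {M : Matrix ι ι ℝ}

/-- Minimum principle for a non-negative matrix with row sums below one. -/
theorem nonneg_of_mulVec_le (hM : ∀ i j, 0 ≤ M i j) (hsum : ∀ i, ∑ j, M i j < 1)
    {x : ι → ℝ} (hx : M *ᵥ x ≤ x) : 0 ≤ x := by
  intro k
  have : Nonempty ι := ⟨k⟩
  obtain ⟨i, hi⟩ := Finite.exists_min x
  refine le_trans ?_ (hi k)
  have hle : (∑ j, M i j) * x i ≤ x i := by
    refine le_trans ?_ (hx i)
    rw [Finset.sum_mul]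
    exact Finset.sum_le_sum fun j _ => mul_le_mul_of_nonneg_left (hi j) (hM i j)
  change 0 ≤ x i
  nlinarith [hsum i]

variable [DecidableEq ι]

theorem isUnit_one_sub_of_sum_row_lt_one (hM : ∀ i j, 0 ≤ M i j)
    (hsum : ∀ i, ∑ j, M i j < 1) : IsUnit (1 - M) := by
  rw [← mulVec_injective_iff_isUnit]
  intro u v huv
  have huv' : (1 - M) *ᵥ (u - v) = 0 := by rw [mulVec_sub, sub_eq_zero]; exact huv
  have hfix : M *ᵥ (u - v) = u - v := by
    rw [sub_mulVec, one_mulVec, sub_eq_zero] at huv'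
    exact huv'.symm
  have hfix_neg : M *ᵥ (v - u) = v - u := by
    rw [← neg_sub u v, mulVec_neg, hfix]
  exact le_antisymm (sub_nonneg.mp (nonneg_of_mulVec_le hM hsum hfix_neg.le))
    (sub_nonneg.mp (nonneg_of_mulVec_le hM hsum hfix.le))

theorem inv_one_sub_mulVec_eq (hM : ∀ i j, 0 ≤ M i j) (hsum : ∀ i, ∑ j, M i j < 1)
    (v : ι → ℝ) : (1 - M)⁻¹ *ᵥ v = v + M *ᵥ ((1 - M)⁻¹ *ᵥ v) := by
  have hdet := (isUnit_iff_isUnit_det _).mp (isUnit_one_sub_of_sum_row_lt_one hM hsum)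
  have h : (1 - M) *ᵥ ((1 - M)⁻¹ *ᵥ v) = v := by
    rw [mulVec_mulVec, mul_nonsing_inv _ hdet, one_mulVec]
  rw [sub_mulVec, one_mulVec] at h
  exact sub_eq_iff_eq_add.mp h

theorem inv_one_sub_mulVec_nonneg (hM : ∀ i j, 0 ≤ M i j) (hsum : ∀ i, ∑ j, M i j < 1)
    {v : ι → ℝ} (hv : 0 ≤ v) : 0 ≤ (1 - M)⁻¹ *ᵥ v := by
  refine nonneg_of_mulVec_le hM hsum ?_
  conv_rhs => rw [inv_one_sub_mulVec_eq hM hsum v]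
  exact le_add_of_nonneg_left hv

theorem inv_one_sub_apply_nonneg (hM : ∀ i j, 0 ≤ M i j) (hsum : ∀ i, ∑ j, M i j < 1)
    (i j : ι) : 0 ≤ (1 - M)⁻¹ i j := by
  have h := inv_one_sub_mulVec_nonneg hM hsum (Pi.single_nonneg.mpr (zero_le_one' ℝ) :
    0 ≤ (Pi.single j 1 : ι → ℝ)) i
  simpa using h

/-- Each entry of `(1 - M)⁻¹ *ᵥ v` is at least the corresponding entry of `v`. -/
theorem le_inv_one_sub_mulVec (hM : ∀ i j, 0 ≤ M i j) (hsum : ∀ i, ∑ j, M i j < 1)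
    {v : ι → ℝ} (hv : 0 ≤ v) : v ≤ (1 - M)⁻¹ *ᵥ v := by
  rw [inv_one_sub_mulVec_eq hM hsum v]
  exact le_add_of_nonneg_right fun i => Finset.sum_nonneg fun j _ =>
    mul_nonneg (hM i j) (inv_one_sub_mulVec_nonneg hM hsum hv j)

end Matrix

/-- Lemma on positivity of the sweep direction under strict
diagonal dominance: with non-negative influences and `I − L` strictly
diagonally dominant, for any partition `Z ∪ W ∪ O = [n]` the matrix
`I − L_{W×W}` is invertible with entrywise non-negative inverse, the vector `ℓ`
given by `ℓ_W = (I − L_{W×W})⁻¹ y_W` and `ℓ_i = y_i + Σ_{j∈W} L_{i,j} ℓ_j`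
elsewhere is strictly positive, and consequently `ε_min > 0`. -/
theorem sweep_direction_positive (n : ℕ) (a b : Fin n → ℝ)
    (T : Matrix (Fin n) (Fin n) ℝ)
    (ha : ∀ i, 0 ≤ a i) (hab : ∀ i, a i < b i)
    (hTdiag : ∀ i, T i i = 0) (hTnn : ∀ i j, 0 ≤ T j i)
    (L : Matrix (Fin n) (Fin n) ℝ) (hL : ∀ i j, L i j = T j i / (b i - a i))
    (hdd : ∀ i, ∑ j, L i j < 1)
    (Z W O : Finset (Fin n))
    (hZW : Disjoint Z W) (hZO : Disjoint Z O) (hWO : Disjoint W O)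
    (hunion : Z ∪ W ∪ O = Finset.univ)
    (y : Fin n → ℝ) (hy : ∀ i, y i = 1 / (b i - a i))
    (Lw : Matrix {i // i ∈ W} {i // i ∈ W} ℝ) (hLw : ∀ i j, Lw i j = L i.1 j.1)
    (ℓ : Fin n → ℝ)
    (hℓW : ∀ i (h : i ∈ W),
      ℓ i = (1 - Lw)⁻¹.mulVec (fun j => y j.1) ⟨i, h⟩)
    (hℓZO : ∀ i, i ∉ W → ℓ i = y i + ∑ j ∈ W, L i j * ℓ j) :
    IsUnit (1 - Lw) ∧
    (∀ i j, 0 ≤ (1 - Lw)⁻¹ i j) ∧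
    (∀ i, 0 < ℓ i) ∧
    (∀ (c : Fin n → ℝ) (εmin : ℝ), (Z ∪ W).Nonempty →
      (∀ i ∈ Z, c i < 0) → (∀ i ∈ W, c i < 1) →
      IsLeast ({x | ∃ i ∈ Z, x = -c i / ℓ i} ∪
        {x | ∃ i ∈ W, x = (1 - c i) / ℓ i}) εmin →
      0 < εmin) := by
  have hLnn : ∀ i j, 0 ≤ L i j := fun i j => by
    rw [hL]
    exact div_nonneg (hTnn i j) (sub_pos.mpr (hab i)).le
  have hypos : ∀ i, 0 < y i := fun i => by
    rw [hy]
    exact one_div_pos.mpr (sub_pos.mpr (hab i))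
  have hM : ∀ i j, 0 ≤ Lw i j := fun i j => by
    rw [hLw]
    exact hLnn _ _
  have hsum : ∀ i, ∑ j, Lw i j < 1 := fun i => by
    refine lt_of_le_of_lt ?_ (hdd i)
    simp only [hLw]
    rw [Finset.sum_coe_sort W (fun j => L i j)]
    exact Finset.sum_le_sum_of_subset_of_nonneg (Finset.subset_univ W) fun j _ _ => hLnn _ j
  have hℓWpos : ∀ i ∈ W, 0 < ℓ i := fun i hi => by
    rw [hℓW i hi]
    exact (hypos i).trans_le
      (Matrix.le_inv_one_sub_mulVec hM hsum (v := fun j => y j.1)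
        (fun j => (hypos j).le) ⟨i, hi⟩)
  have hℓpos : ∀ i, 0 < ℓ i := fun i => by
    by_cases hi : i ∈ W
    · exact hℓWpos i hi
    · rw [hℓZO i hi]
      exact add_pos_of_pos_of_nonneg (hypos i)
        (Finset.sum_nonneg fun j hj => mul_nonneg (hLnn i j) (hℓWpos j hj).le)
  refine ⟨Matrix.isUnit_one_sub_of_sum_row_lt_one hM hsum,
    Matrix.inv_one_sub_apply_nonneg hM hsum, hℓpos, ?_⟩
  rintro c εmin - hcZ hcW ⟨⟨i, hi, rfl⟩ | ⟨i, hi, rfl⟩, -⟩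
  · exact div_pos (neg_pos.mpr (hcZ i hi)) (hℓpos i)
  · exact div_pos (sub_pos.mpr (hcW i hi)) (hℓpos i)
end

section
/- Assume all influences are non-negative, I − L is strictly diagonally dominant, p_t is a price, and Z ∪ W ∪ O is an admissible partition at p_t with Z ∪ W ≠ ∅. Define ℓ_W = (I − L_{W×W})^{-1} y_W, ℓ_i = y_i + Σ_{j∈W} L_{i,j} ℓ_j for i ∈ Z ∪ O, ε_min = min( min_{i∈Z} (−[x + Lq^t]_i)/ℓ_i , min_{i∈W} (1 − [x + Lq^t]_i)/ℓ_i ), and r_W(ε) = ε (I − L_{W×W})^{-1} y_W + q^t_W. Then for every ε with 0 < ε ≤ ε_min, the pessimistic equilibrium at price p_t − ε equals the vector that is 0 on Z, r_W(ε) on W, and 1 on O: q̲(p_t − ε) = ⟨0_Z, r_W(ε), 1_O⟩. -/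
open Filter Topology

theorem abs_med_sub_med_le (u v : ℝ) : |med u - med v| ≤ |u - v| := by
  unfold med
  calc |max 0 (min 1 u) - max 0 (min 1 v)|
      ≤ |min 1 u - min 1 v| := by simpa using abs_max_sub_max_le_max 0 (min 1 u) 0 (min 1 v)
    _ ≤ |u - v| := by simpa using abs_min_sub_min_le_max 1 u 1 v

/-- If the scaled influence matrix is non-negative with row sums below one, then the iterates of
the transfer function converge to any of its fixed points. -/
theorem tendsto_iterate_transfer {ι : Type*} [Fintype ι] {a b : ι → ℝ}
    {T L : Matrix ι ι ℝ} (hL : ∀ i j, L i j = T j i / (b i - a i)) (hLnn : ∀ i j, 0 ≤ L i j)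
    (hdd : ∀ i, ∑ j, L i j < 1) {p : ℝ} {q : ι → ℝ} (hq : transfer a b T p q = q)
    (u : ι → ℝ) : Tendsto (fun m : ℕ => (transfer a b T p)^[m] u) atTop (𝓝 q) := by
  cases isEmpty_or_nonempty ι with
  | inl _ => simp [Subsingleton.elim _ q]
  | inr _ =>
    obtain ⟨k, -, hk⟩ := Finset.exists_max_image Finset.univ (fun i => ∑ j, L i j)
      Finset.univ_nonempty
    have hc0 : 0 ≤ ∑ j, L k j := Finset.sum_nonneg fun j _ => hLnn k j
    have hlip : LipschitzWith (∑ j, L k j).toNNReal (transfer a b T p) := by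
      refine LipschitzWith.of_dist_le_mul fun v w => ?_
      rw [Real.coe_toNNReal _ hc0, dist_pi_le_iff (mul_nonneg hc0 dist_nonneg)]
      intro i
      rw [Real.dist_eq]
      calc |transfer a b T p v i - transfer a b T p w i|
          ≤ |(b i - p + ∑ j, T j i * v j) / (b i - a i)
              - (b i - p + ∑ j, T j i * w j) / (b i - a i)| := abs_med_sub_med_le _ _
        _ = |∑ j, L i j * (v j - w j)| := by
            rw [← sub_div, add_sub_add_left_eq_sub, ← Finset.sum_sub_distrib, Finset.sum_div]
            congr 1
            refine Finset.sum_congr rfl fun j _ => ?_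
            rw [hL]
            ring
        _ ≤ ∑ j, L i j * dist v w := by
            refine (Finset.abs_sum_le_sum_abs _ _).trans (Finset.sum_le_sum fun j _ => ?_)
            rw [abs_mul, abs_of_nonneg (hLnn i j), ← Real.dist_eq]
            exact mul_le_mul_of_nonneg_left (dist_le_pi_dist v w j) (hLnn i j)
        _ ≤ (∑ j, L k j) * dist v w := by
            rw [← Finset.sum_mul]
            exact mul_le_mul_of_nonneg_right (hk i (Finset.mem_univ i)) dist_nonneg
    have hcontr : ContractingWith (∑ j, L k j).toNNReal (transfer a b T p) :=
      ⟨by simpa [Real.toNNReal_lt_one] using hdd k, hlip⟩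
    rw [hcontr.fixedPoint_unique hq]
    exact hcontr.tendsto_iterate_fixedPoint u

/-- A matrix `M` that is non-negative with row sums below one makes `1 - M` invertible. -/
theorem isUnit_det_one_sub {κ : Type*} [Fintype κ] [DecidableEq κ] {M : Matrix κ κ ℝ}
    (hM : ∀ i j, 0 ≤ M i j) (hrow : ∀ i, ∑ j, M i j < 1) : IsUnit (1 - M).det := by
  rw [isUnit_iff_ne_zero]
  refine det_ne_zero_of_sum_row_lt_diag fun k => ?_
  have hsum := Finset.add_sum_erase Finset.univ (fun j => M k j) (Finset.mem_univ k)
  have hoff : ∑ j ∈ Finset.univ.erase k, ‖(1 - M) k j‖ = ∑ j ∈ Finset.univ.erase k, M k j := by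
    refine Finset.sum_congr rfl fun j hj => ?_
    rw [Matrix.sub_apply, Matrix.one_apply_ne (Finset.ne_of_mem_erase hj).symm, zero_sub,
      norm_neg, Real.norm_of_nonneg (hM k j)]
  have hdiag : ‖(1 - M) k k‖ = 1 - M k k := by
    have hoff_nn : 0 ≤ ∑ j ∈ Finset.univ.erase k, M k j := Finset.sum_nonneg fun j _ => hM k j
    rw [Matrix.sub_apply, Matrix.one_apply_eq, Real.norm_of_nonneg]
    linarith [hrow k]
  rw [hoff, hdiag]
  linarith [hrow k]

/-- A solution of `v = y + M v` on `W`, with `y` non-negative and `M` non-negative with row sums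
below one, is non-negative on `W`. -/
theorem nonneg_of_eq_add_sum {ι : Type*} {W : Finset ι} {M : Matrix ι ι ℝ} {y v : ι → ℝ}
    (hM : ∀ i j, 0 ≤ M i j) (hrow : ∀ i, ∑ j ∈ W, M i j < 1) (hy : ∀ i, 0 ≤ y i)
    (hv : ∀ i ∈ W, v i = y i + ∑ j ∈ W, M i j * v j) : ∀ i ∈ W, 0 ≤ v i := by
  intro i hi
  obtain ⟨k, hkW, hk⟩ := Finset.exists_min_image W v ⟨i, hi⟩
  refine le_trans ?_ (hk i hi)
  have hsum : (∑ j ∈ W, M k j) * v k ≤ ∑ j ∈ W, M k j * v j := by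
    rw [Finset.sum_mul]
    exact Finset.sum_le_sum fun j hj => mul_le_mul_of_nonneg_left (hk j hj) (hM k j)
  have hvk := hv k hkW
  by_contra! hneg
  nlinarith [hy k, hrow k]

/-- Lemma: `q̲(p_t − ε) = ⟨0_Z, r_W(ε), 1_O⟩`: with non-negative
influences and `I − L` strictly diagonally dominant, given an admissible
partition `Z ∪ W ∪ O` at price `p_t` with `Z ∪ W ≠ ∅`, for every
`0 < ε ≤ ε_min` the pessimistic equilibrium at price `p_t − ε` (the
componentwise limit of the iterates of `f_{p_t−ε}` from `0`) is exactly the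
vector that is `0` on `Z`, `r_W(ε) = ε (I − L_{W×W})⁻¹ y_W + q^t_W` on `W`,
and `1` on `O`. -/
theorem sweep_step_pessimistic (n : ℕ) (a b : Fin n → ℝ)
    (T : Matrix (Fin n) (Fin n) ℝ)
    (ha : ∀ i, 0 ≤ a i) (hab : ∀ i, a i < b i)
    (hTdiag : ∀ i, T i i = 0) (hTnn : ∀ i j, 0 ≤ T j i)
    (L : Matrix (Fin n) (Fin n) ℝ) (hL : ∀ i j, L i j = T j i / (b i - a i))
    (hdd : ∀ i, ∑ j, L i j < 1)
    (pt : ℝ) (qt : Fin n → ℝ)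
    -- q^t = q̲(p_t), the pessimistic equilibrium at price p_t
    (hqt : ∀ i, Tendsto (fun m : ℕ => (transfer a b T pt)^[m] (fun _ => 0) i)
      atTop (𝓝 (qt i)))
    (x y : Fin n → ℝ)
    (hx : ∀ i, x i = (b i - pt) / (b i - a i))
    (hy : ∀ i, y i = 1 / (b i - a i))
    -- admissible partition at p_t
    (Z W O : Finset (Fin n))
    (hZW : Disjoint Z W) (hZO : Disjoint Z O) (hWO : Disjoint W O)
    (hunion : Z ∪ W ∪ O = Finset.univ)
    (hZ : ∀ i ∈ Z, qt i = 0 ∧ (x + L.mulVec qt) i < 0)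
    (hW : ∀ i ∈ W, qt i = (x + L.mulVec qt) i ∧ 0 ≤ qt i ∧ qt i < 1)
    (hO : ∀ i ∈ O, qt i = 1 ∧ 1 ≤ (x + L.mulVec qt) i)
    (hne : (Z ∪ W).Nonempty)
    (Lw : Matrix {i // i ∈ W} {i // i ∈ W} ℝ) (hLw : ∀ i j, Lw i j = L i.1 j.1)
    (ℓ : Fin n → ℝ)
    (hℓW : ∀ i (h : i ∈ W),
      ℓ i = (1 - Lw)⁻¹.mulVec (fun j => y j.1) ⟨i, h⟩)
    (hℓZO : ∀ i, i ∉ W → ℓ i = y i + ∑ j ∈ W, L i j * ℓ j)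
    (εmin : ℝ)
    (hεmin : IsLeast ({z | ∃ i ∈ Z, z = -((x + L.mulVec qt) i) / ℓ i} ∪
      {z | ∃ i ∈ W, z = (1 - (x + L.mulVec qt) i) / ℓ i}) εmin)
    (ε : ℝ) (hε : 0 < ε) (hεle : ε ≤ εmin)
    (q : Fin n → ℝ)
    (hq : ∀ i, q i = if i ∈ Z then 0
      else if h : i ∈ W then
        ε * (1 - Lw)⁻¹.mulVec (fun j => y j.1) ⟨i, h⟩ + qt i
      else 1) :
    ∀ i, Tendsto (fun m : ℕ => (transfer a b T (pt - ε))^[m] (fun _ => 0) i)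
      atTop (𝓝 (q i)) := by
  have hd : ∀ i, 0 < b i - a i := fun i => sub_pos.2 (hab i)
  have hLnn : ∀ i j, 0 ≤ L i j := fun i j => by
    rw [hL]
    exact div_nonneg (hTnn i j) (hd i).le
  have hypos : ∀ i, 0 < y i := fun i => by
    rw [hy]
    exact one_div_pos.2 (hd i)
  have hrowW : ∀ i, ∑ j ∈ W, L i j < 1 := fun i =>
    (Finset.sum_le_univ_sum_of_nonneg (hLnn i)).trans_lt (hdd i)
  have hunit : IsUnit (1 - Lw).det := by
    refine isUnit_det_one_sub (fun i j => hLw i j ▸ hLnn _ _) fun i => ?_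
    simp only [hLw]
    rw [Finset.sum_coe_sort W (fun j => L i.1 j)]
    exact hrowW i
  have hℓ : ∀ i, ℓ i = y i + ∑ j ∈ W, L i j * ℓ j := by
    intro i
    by_cases hi : i ∈ W
    · have hsolve : (1 - Lw).mulVec (fun j => ℓ j.1) = fun j => y j.1 := by
        have hfun : (fun j : {i // i ∈ W} => ℓ j.1) = (1 - Lw)⁻¹.mulVec (fun j => y j.1) :=
          funext fun j => hℓW j.1 j.2
        rw [hfun, Matrix.mulVec_mulVec, Matrix.mul_nonsing_inv _ hunit, Matrix.one_mulVec]
      have hsolve_i := congrFun hsolve ⟨i, hi⟩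
      rw [Matrix.sub_mulVec, Matrix.one_mulVec] at hsolve_i
      simp only [Pi.sub_apply, Matrix.mulVec, dotProduct, hLw] at hsolve_i
      rw [Finset.sum_coe_sort W (fun j => L i j * ℓ j)] at hsolve_i
      linarith
    · exact hℓZO i hi
  have hℓW_nn : ∀ i ∈ W, 0 ≤ ℓ i :=
    nonneg_of_eq_add_sum hLnn hrowW (fun i => (hypos i).le) fun i _ => hℓ i
  have hℓpos : ∀ i, 0 < ℓ i := fun i => by
    rw [hℓ]
    exact add_pos_of_pos_of_nonneg (hypos i)
      (Finset.sum_nonneg fun j hj => mul_nonneg (hLnn i j) (hℓW_nn j hj))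
  have hcases : ∀ i, i ∈ Z ∨ i ∈ W ∨ i ∈ O := fun i => by
    have hi := Finset.mem_univ i
    rw [← hunion, Finset.mem_union, Finset.mem_union] at hi
    tauto
  have hqZ : ∀ i ∈ Z, q i = 0 := fun i hi => by rw [hq, if_pos hi]
  have hqW : ∀ i ∈ W, q i = qt i + ε * ℓ i := fun i hi => by
    rw [hq, if_neg (Finset.disjoint_right.1 hZW hi), dif_pos hi, hℓW i hi, add_comm]
  have hqO : ∀ i ∈ O, q i = 1 := fun i hi => by
    rw [hq, if_neg (Finset.disjoint_right.1 hZO hi), dif_neg (Finset.disjoint_right.1 hWO hi)]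
  have hq_shift : ∀ i, q i = qt i + if i ∈ W then ε * ℓ i else 0 := by
    intro i
    rcases hcases i with hi | hi | hi
    · rw [if_neg (Finset.disjoint_left.1 hZW hi), hqZ i hi, (hZ i hi).1, add_zero]
    · rw [if_pos hi, hqW i hi]
    · rw [if_neg (Finset.disjoint_right.1 hWO hi), hqO i hi, (hO i hi).1, add_zero]
  have harg : ∀ i, (b i - (pt - ε) + ∑ j, T j i * q j) / (b i - a i)
      = (x + L.mulVec qt) i + ε * ℓ i := by
    intro i
    have hsum : ∑ j, L i j * q j = ∑ j, L i j * qt j + ε * ∑ j ∈ W, L i j * ℓ j := by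
      simp only [hq_shift, mul_add, Finset.sum_add_distrib, mul_ite, mul_zero,
        Finset.sum_ite_mem, Finset.univ_inter, Finset.mul_sum]
      congr 1
      exact Finset.sum_congr rfl fun j _ => by ring
    have hdiv : (∑ j, T j i * q j) / (b i - a i) = ∑ j, L i j * q j := by
      rw [Finset.sum_div]
      exact Finset.sum_congr rfl fun j _ => by rw [hL]; ring
    rw [add_div, hdiv, hsum, hℓ i, Pi.add_apply, hx, hy]
    simp only [Matrix.mulVec, dotProduct]
    ring
  have hfix : transfer a b T (pt - ε) q = q := by
    funext i
    simp only [transfer, harg, med]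
    rcases hcases i with hi | hi | hi
    · have hle := hεle.trans (hεmin.2 (Or.inl ⟨i, hi, rfl⟩))
      rw [le_div_iff₀ (hℓpos i)] at hle
      rw [hqZ i hi]
      exact max_eq_left (min_le_of_right_le (by linarith))
    · have hle := hεle.trans (hεmin.2 (Or.inr ⟨i, hi, rfl⟩))
      rw [le_div_iff₀ (hℓpos i)] at hle
      obtain ⟨heq, hnn, -⟩ := hW i hi
      rw [hqW i hi, ← heq, min_eq_right (by linarith)]
      exact max_eq_right (add_nonneg hnn (mul_pos hε (hℓpos i)).le)
    · rw [hqO i hi, min_eq_left, max_eq_right zero_le_one]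
      linarith [(hO i hi).2, mul_pos hε (hℓpos i)]
  exact tendsto_pi_nhds.1 (tendsto_iterate_transfer hL hLnn hdd hfix _)
end

section
/- Let M be an entrywise non-negative real square matrix. If I − M is invertible and (I − M)^{-1} is entrywise non-negative, then ρ(M) < 1. -/
open Filter Topology

/-- The spectral radius of a real square matrix: the maximum modulus of its
complex eigenvalues (the supremum of `‖λ‖` over the complex spectrum). -/
noncomputable def specRad {m : Type*} [Fintype m] [DecidableEq m]
    (M : Matrix m m ℝ) : ℝ :=
  sSup ((fun z : ℂ => ‖z‖) '' spectrum ℂ (M.map Complex.ofReal))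

open scoped Matrix in
/-- The entrywise modulus `x` of a complex eigenvector for an eigenvalue of modulus at least one
satisfies `x ≤ M x`, so non-negativity of `(1 - M)⁻¹` forces `x ≤ 0`. -/
theorem norm_lt_one_of_mem_spectrum {m : Type*} [Fintype m] [DecidableEq m]
    {M : Matrix m m ℝ} (hM : ∀ i j, 0 ≤ M i j)
    (hinv : IsUnit (1 - M)) (hnn : ∀ i j, 0 ≤ (1 - M)⁻¹ i j)
    {z : ℂ} (hz : z ∈ spectrum ℂ (M.map Complex.ofReal)) : ‖z‖ < 1 := by
  rw [← Matrix.spectrum_toLin', ← Module.End.hasEigenvalue_iff_mem_spectrum] at hz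
  obtain ⟨v, hv⟩ := hz.exists_hasEigenvector
  have hMv : M.map Complex.ofReal *ᵥ v = z • v := by
    simpa using hv.apply_eq_smul
  by_contra! hz1
  set x : m → ℝ := fun i => ‖v i‖ with hx
  have hle : ∀ i, ((1 - M) *ᵥ x) i ≤ 0 := fun i => by
    have hzv : ‖z‖ * ‖v i‖ ≤ (M *ᵥ x) i := by
      rw [← norm_mul, ← smul_eq_mul, ← Pi.smul_apply, ← hMv]
      refine (norm_sum_le _ _).trans_eq (Finset.sum_congr rfl fun j _ => ?_)
      simp [hx, abs_of_nonneg (hM i j)]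
    have hvi : ‖v i‖ ≤ ‖z‖ * ‖v i‖ := le_mul_of_one_le_left (norm_nonneg _) hz1
    rw [Matrix.sub_mulVec, Matrix.one_mulVec, Pi.sub_apply, sub_nonpos]
    exact hvi.trans hzv
  have hxinv : (1 - M)⁻¹ *ᵥ ((1 - M) *ᵥ x) = x := by
    rw [Matrix.mulVec_mulVec,
      Matrix.nonsing_inv_mul _ ((Matrix.isUnit_iff_isUnit_det _).mp hinv), Matrix.one_mulVec]
  refine hv.2 (funext fun i => norm_le_zero_iff.mp ?_)
  change x i ≤ 0
  rw [← hxinv]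
  exact Finset.sum_nonpos fun j _ => mul_nonpos_of_nonneg_of_nonpos (hnn i j) (hle j)

/-- if `M` is entrywise non-negative, `I − M` is invertible and
`(I − M)⁻¹` is entrywise non-negative, then `ρ(M) < 1`. -/
theorem specRad_lt_one_of_inv_nonneg {m : Type*} [Fintype m] [DecidableEq m]
    (M : Matrix m m ℝ) (hM : ∀ i j, 0 ≤ M i j)
    (hinv : IsUnit (1 - M)) (hnn : ∀ i j, 0 ≤ (1 - M)⁻¹ i j) :
    specRad M < 1 := by
  unfold specRad
  rcases (spectrum ℂ (M.map Complex.ofReal)).eq_empty_or_nonempty with h | h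
  · simp [h]
  · have hfin := (Matrix.finite_spectrum (M.map Complex.ofReal)).image fun z : ℂ => ‖z‖
    obtain ⟨z, hz, hzeq⟩ := (h.image _).csSup_mem hfin
    rw [← hzeq]
    exact norm_lt_one_of_mem_spectrum hM hinv hnn hz
end

section
/- Let M be an entrywise non-negative real square matrix. If I − M is not invertible, or if I − M is invertible but (I − M)^{-1} contains at least one negative entry, then ρ(M) ≥ 1. -/
open Filter Topology

section LinftyOpNorm

attribute [local instance] Matrix.linftyOpNormedRing Matrix.linftyOpNormedAlgebra

/-- The powers of an element of a complex Banach algebra with spectral radius less than one tend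
to zero. -/
theorem tendsto_pow_zero_of_spectralRadius_lt_one {A : Type*} [NormedRing A] [NormedAlgebra ℂ A]
    [CompleteSpace A] {a : A} (ha : spectralRadius ℂ a < 1) :
    Tendsto (fun n : ℕ => a ^ n) atTop (𝓝 0) := by
  obtain ⟨r, har, hr⟩ := ENNReal.lt_iff_exists_nnreal_btwn.1 ha
  have hr' : r < 1 := by exact_mod_cast hr
  have hlim := spectrum.pow_nnnorm_pow_one_div_tendsto_nhds_spectralRadius a
  refine squeeze_zero_norm' ?_ (tendsto_pow_atTop_nhds_zero_of_lt_one r.coe_nonneg hr')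
  filter_upwards [hlim.eventually (gt_mem_nhds har), eventually_gt_atTop 0] with n hn hpos
  have hn0 : (n : ℝ) ≠ 0 := by positivity
  have hpow := ENNReal.rpow_le_rpow hn.le (Nat.cast_nonneg (α := ℝ) n)
  rw [← ENNReal.rpow_mul, one_div, inv_mul_cancel₀ hn0, ENNReal.rpow_one,
    ENNReal.rpow_natCast] at hpow
  exact_mod_cast hpow

/-- The powers of a complex matrix all of whose eigenvalues have modulus less than one tend to
zero. -/
theorem Matrix.tendsto_pow_zero_of_forall_norm_lt_one {m : Type*} [Fintype m] [DecidableEq m]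
    [Nonempty m] {A : Matrix m m ℂ} (hA : ∀ z ∈ spectrum ℂ A, ‖z‖ < 1) :
    Tendsto (fun n : ℕ => A ^ n) atTop (𝓝 0) := by
  have : CompleteSpace (Matrix m m ℂ) := FiniteDimensional.complete ℂ _
  refine tendsto_pow_zero_of_spectralRadius_lt_one ?_
  exact_mod_cast spectrum.spectralRadius_lt_of_forall_lt A (r := 1) fun z hz => hA z hz

end LinftyOpNorm

theorem norm_le_specRad {m : Type*} [Fintype m] [DecidableEq m] (M : Matrix m m ℝ) {z : ℂ}
    (hz : z ∈ spectrum ℂ (M.map Complex.ofReal)) : ‖z‖ ≤ specRad M :=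
  le_csSup ((Matrix.finite_spectrum (M.map Complex.ofReal)).image _).bddAbove ⟨z, hz, rfl⟩

theorem tendsto_pow_zero_of_specRad_lt_one {m : Type*} [Fintype m] [DecidableEq m]
    {M : Matrix m m ℝ} (h : specRad M < 1) : Tendsto (fun n : ℕ => M ^ n) atTop (𝓝 0) := by
  rcases isEmpty_or_nonempty m with _ | _
  · simpa only [Subsingleton.elim _ (0 : Matrix m m ℝ)] using tendsto_const_nhds
  have hlim := Matrix.tendsto_pow_zero_of_forall_norm_lt_one
    fun z hz => (norm_le_specRad M hz).trans_lt h
  have hre := ((continuous_id.matrix_map Complex.continuous_re).tendsto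
    (0 : Matrix m m ℂ)).comp hlim
  convert hre using 1
  · ext n i j
    have hpow : (M.map Complex.ofReal) ^ n = (M ^ n).map Complex.ofReal :=
      (map_pow (Complex.ofRealHom.mapMatrix) M n).symm
    simp [hpow]
  · simp

theorem isUnit_one_sub_of_specRad_lt_one {m : Type*} [Fintype m] [DecidableEq m]
    {M : Matrix m m ℝ} (h : specRad M < 1) : IsUnit (1 - M) := by
  have h1 : (1 : ℂ) ∉ spectrum ℂ (M.map Complex.ofReal) := fun hz =>
    absurd (norm_le_specRad M hz) (by simpa using h)
  rw [spectrum.notMem_iff, map_one] at h1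
  have hmap : 1 - M.map Complex.ofReal = Complex.ofRealHom.mapMatrix (1 - M) := by
    rw [map_sub, map_one]; rfl
  rw [hmap, Matrix.isUnit_iff_isUnit_det, ← RingHom.map_det, isUnit_map_iff] at h1
  exact (Matrix.isUnit_iff_isUnit_det _).2 h1

theorem inv_one_sub_apply_nonneg_of_specRad_lt_one {m : Type*} [Fintype m] [DecidableEq m]
    {M : Matrix m m ℝ} (hM : ∀ i j, 0 ≤ M i j) (h : specRad M < 1) (i j : m) :
    0 ≤ (1 - M)⁻¹ i j := by
  have hdet := (Matrix.isUnit_iff_isUnit_det _).1 (isUnit_one_sub_of_specRad_lt_one h)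
  have hsum (n : ℕ) : (1 - M)⁻¹ * (1 - M ^ n) = ∑ k ∈ Finset.range n, M ^ k := by
    rw [← mul_neg_geom_sum, Matrix.nonsing_inv_mul_cancel_left _ _ hdet]
  have hlim : Tendsto (fun n : ℕ => (1 - M)⁻¹ * (1 - M ^ n)) atTop (𝓝 (1 - M)⁻¹) := by
    simpa using (tendsto_const_nhds (x := (1 - M)⁻¹)).mul
      ((tendsto_const_nhds (x := (1 : Matrix m m ℝ))).sub (tendsto_pow_zero_of_specRad_lt_one h))
  refine ge_of_tendsto' ((hlim.apply_nhds i).apply_nhds j) fun n => ?_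
  rw [hsum, Matrix.sum_apply]
  exact Finset.sum_nonneg fun k _ => Matrix.pow_apply_nonneg hM k i j

/-- if `M` is entrywise non-negative, and either `I − M` is not
invertible, or `I − M` is invertible but `(I − M)⁻¹` has a negative entry,
then `ρ(M) ≥ 1`. -/
theorem one_le_specRad_of_singular_or_neg_entry {m : Type*} [Fintype m]
    [DecidableEq m] (M : Matrix m m ℝ) (hM : ∀ i j, 0 ≤ M i j)
    (h : ¬ IsUnit (1 - M) ∨ (IsUnit (1 - M) ∧ ∃ i j, (1 - M)⁻¹ i j < 0)) :
    1 ≤ specRad M := by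
  by_contra! hlt
  rcases h with h | ⟨-, i, j, hij⟩
  · exact h (isUnit_one_sub_of_specRad_lt_one hlt)
  · exact hij.not_ge (inv_one_sub_apply_nonneg_of_specRad_lt_one hM hlt i j)
end

section
/- Let n = 2, with valuation intervals [a_1,b_1] = [a_2,b_2] = [0,1] and influences T_{1,2} = T_{2,1} = 2 (and zero diagonal). Then the pessimistic equilibrium satisfies q̲(p) = (0,0) for every price p ≥ 1 and q̲(p) = (1,1) for every price p < 1. In particular, the map p ↦ q̲(p) is not left-continuous at p = 1. -/
open Filter Topology

theorem med_nonneg (x : ℝ) : 0 ≤ med x := le_max_left _ _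

theorem med_le_one (x : ℝ) : med x ≤ 1 := max_le zero_le_one (min_le_left _ _)

theorem med_of_nonpos {x : ℝ} (hx : x ≤ 0) : med x = 0 :=
  max_eq_left ((min_le_right _ _).trans hx)

theorem le_med_of_med_lt_one {x : ℝ} (h : med x < 1) : x ≤ med x := by
  unfold med at *
  grind

/-- A mutual best response with influences `2` and price below `1` is saturated. -/
theorem eq_one_of_eq_med {p x y : ℝ} (hp : p < 1) (hx : x = med (1 - p + 2 * y))
    (hy : y = med (1 - p + 2 * x)) : x = 1 := by
  have hx0 : 0 ≤ x := hx ▸ med_nonneg _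
  have hy0 : 0 ≤ y := hy ▸ med_nonneg _
  have hx1 : x ≤ 1 := hx ▸ med_le_one _
  by_contra hne
  have hxlt : x < 1 := lt_of_le_of_ne hx1 hne
  have hxy : 1 - p + 2 * y ≤ x := by
    rw [hx] at hxlt
    exact (le_med_of_med_lt_one hxlt).trans_eq hx.symm
  have hylt : y < 1 := by linarith
  have hyx : 1 - p + 2 * x ≤ y := by
    rw [hy] at hylt
    exact (le_med_of_med_lt_one hylt).trans_eq hy.symm
  linarith

/-- equilibrium jump: for `n = 2` agents with valuation
intervals `[0,1]` and mutual influences `T_{1,2} = T_{2,1} = 2`, the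
pessimistic equilibrium is `(0,0)` for every price `p ≥ 1` and `(1,1)` for
every price `p < 1`; in particular `p ↦ q̲(p)` is not left-continuous at
`p = 1`. -/
theorem equilibrium_jump
    (a b : Fin 2 → ℝ) (T : Matrix (Fin 2) (Fin 2) ℝ)
    (haa : ∀ i, a i = 0) (hbb : ∀ i, b i = 1)
    (hTT : ∀ j i, T j i = if j = i then 0 else 2)
    (qlow : ℝ → Fin 2 → ℝ)
    (hqlow : ∀ p i, Tendsto (fun m : ℕ => (transfer a b T p)^[m] (fun _ => 0) i)
      atTop (𝓝 (qlow p i))) :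
    (∀ p : ℝ, 1 ≤ p → ∀ i, qlow p i = 0) ∧
    (∀ p : ℝ, p < 1 → ∀ i, qlow p i = 1) ∧
    ¬ (∀ i, Tendsto (fun p : ℝ => qlow p i) (𝓝[<] 1) (𝓝 (qlow 1 i))) := by
  have htransfer : ∀ p q, transfer a b T p q =
      ![med (1 - p + 2 * q 1), med (1 - p + 2 * q 0)] := by
    intro p q
    ext i
    fin_cases i <;> simp [transfer, haa, hbb, hTT]
  have hzero : ∀ p : ℝ, 1 ≤ p → ∀ i, qlow p i = 0 := by
    intro p hp i
    have hfix : transfer a b T p (fun _ => 0) = fun _ => 0 := by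
      rw [htransfer]
      ext i
      fin_cases i <;> simp [med_of_nonpos (sub_nonpos.2 hp)]
    have h := hqlow p i
    simp only [Function.iterate_fixed hfix] at h
    exact tendsto_nhds_unique h tendsto_const_nhds
  have hone : ∀ p : ℝ, p < 1 → ∀ i, qlow p i = 1 := by
    intro p hp i
    have hfix : transfer a b T p (qlow p) = qlow p :=
      isFixedPt_of_tendsto_iterate (tendsto_pi_nhds.2 (hqlow p))
        (continuous_transfer a b T p).continuousAt
    rw [htransfer] at hfix
    have h0 : qlow p 0 = med (1 - p + 2 * qlow p 1) := (congrFun hfix 0).symm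
    have h1 : qlow p 1 = med (1 - p + 2 * qlow p 0) := (congrFun hfix 1).symm
    fin_cases i
    · exact eq_one_of_eq_med hp h0 h1
    · exact eq_one_of_eq_med hp h1 h0
  refine ⟨hzero, hone, fun hcont => ?_⟩
  have h := hcont 0
  rw [hzero 1 le_rfl 0] at h
  have hconst : Tendsto (fun p : ℝ => qlow p 0) (𝓝[<] 1) (𝓝 1) :=
    tendsto_const_nhds.congr' (eventually_nhdsWithin_of_forall fun p hp => (hone p hp 0).symm)
  exact zero_ne_one (tendsto_nhds_unique h hconst)
end
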